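/- If the truthful profile (s^t,…,s^t) is not an equilibrium of the competitive protocol F^c, then there exists a fanatic agent. -/

import Mathlib

open scoped Classical
noncomputable section

/-- A strategy of an agent: `(p, q)` with `p = P(mᵢ = 0 ∣ bᵢ = 0)`, `q = P(mᵢ = 0 ∣ bᵢ = 1)`. -/
abbrev Strategy : Type := (Set.Icc (0:ℝ) 1) × (Set.Icc (0:ℝ) 1)

/-- The truthful strategy `sᵗ = (1,0)`. -/
def sT : Strategy := (⟨1, by norm_num⟩, ⟨0, by norm_num⟩)

/-- A zero-information strategy: `p = q`. -/
def ZeroInfo (s : Strategy) : Prop := (s.1 : ℝ) = (s.2 : ℝ)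

/-- Vectors of `N+1` bits (bits of the center and the `N` agents; also used for
message vectors and for the center's replies).  Coordinate `0` is the center. -/
abbrev Bits (N : ℕ) : Type := Fin (N+1) → Bool

/-- A strategy profile of the `N` agents. -/
abbrev Profile (N : ℕ) : Type := Fin N → Strategy

/-- A protocol for a single agent: a map from strategy profiles and message vectors to
distributions over replies `f ∈ {0,1}^{N+1}`. -/
abbrev Protocol (N : ℕ) : Type := Profile N → Bits N → PMF (Bits N)

/-- `P(message = msg ∣ bit = bit)` under strategy `s` (where `false` plays the role of `0`). -/
def strandP (s : Strategy) (bit msg : Bool) : ℝ :=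
  if msg then 1 - (if bit then (s.2 : ℝ) else (s.1 : ℝ))
  else (if bit then (s.2 : ℝ) else (s.1 : ℝ))

/-- `P(messages = m ∣ bits = b)` under profile `s`; the center's message is her own bit. -/
def msgP {N : ℕ} (s : Profile N) (b m : Bits N) : ℝ :=
  (if m 0 = b 0 then (1:ℝ) else 0) * ∏ i : Fin N, strandP (s i) (b i.succ) (m i.succ)

/-- Joint probability of bits `b`, messages `m` and reply `f` (to the relevant agent),
under profile `s` and protocol `F`; bits are i.i.d. uniform. -/
def jointP {N : ℕ} (s : Profile N) (F : Protocol N) (b m f : Bits N) : ℝ :=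
  ((1:ℝ)/2)^(N+1) * msgP s b m * ((F s m) f).toReal

/-- `P(bᵢ = bi, mᵢ = mi, fᵢ = f, g(b) = val)` for agent `i` (coordinate `i.succ`). -/
def pObs {N : ℕ} (g : Bits N → Bool) (s : Profile N) (F : Protocol N) (i : Fin N)
    (bi mi : Bool) (f : Bits N) (val : Bool) : ℝ :=
  ∑ b : Bits N, ∑ m : Bits N,
    if b i.succ = bi ∧ m i.succ = mi ∧ g b = val then jointP s F b m f else 0

/-- `P(bᵢ = bi, mᵢ = mi, fᵢ = f)` for agent `i`. -/
def pObsAll {N : ℕ} (s : Profile N) (F : Protocol N) (i : Fin N)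
    (bi mi : Bool) (f : Bits N) : ℝ :=
  ∑ b : Bits N, ∑ m : Bits N,
    if b i.succ = bi ∧ m i.succ = mi then jointP s F b m f else 0

/-- `P(b_k = 1, bᵢ = bi, mᵢ = mi, fᵢ = f)` for agent `i`. -/
def pBit {N : ℕ} (s : Profile N) (F : Protocol N) (i : Fin N)
    (bi mi : Bool) (f : Bits N) (k : Fin (N+1)) : ℝ :=
  ∑ b : Bits N, ∑ m : Bits N,
    if b i.succ = bi ∧ m i.succ = mi ∧ b k = true then jointP s F b m f else 0

/-- The posterior `v_k = P(b_k = 1 ∣ fᵢ, mᵢ, bᵢ)` of agent `i` at the realization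
`(bi, mi, f)`. -/
def post {N : ℕ} (s : Profile N) (F : Protocol N) (i : Fin N)
    (bi mi : Bool) (f : Bits N) (k : Fin (N+1)) : ℝ :=
  pBit s F i bi mi f k / pObsAll s F i bi mi f

/-- Expected profit `V_i(s⃗; F_i)`: after observing `(bᵢ, mᵢ, fᵢ)` the agent guesses the
more likely value of `g(b)` (uniformly at random in case of a tie) and earns `c i` iff
the guess is correct. -/
def V {N : ℕ} (g : Bits N → Bool) (c : Fin N → ℝ) (s : Profile N) (F : Protocol N)
    (i : Fin N) : ℝ :=
  c i * ∑ bi : Bool, ∑ mi : Bool, ∑ f : Bits N,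
    (if pObs g s F i bi mi f true > pObs g s F i bi mi f false then pObs g s F i bi mi f true
     else if pObs g s F i bi mi f false > pObs g s F i bi mi f true then
       pObs g s F i bi mi f false
     else (pObs g s F i bi mi f false + pObs g s F i bi mi f true) / 2)

/-- Utility `U_i(s⃗; F_i) = V_i(s⃗; F_i) − priceᵢ(sᵢ)`. -/
def U {N : ℕ} (g : Bits N → Bool) (c : Fin N → ℝ) (price : Fin N → Strategy → ℝ)
    (s : Profile N) (F : Protocol N) (i : Fin N) : ℝ :=
  V g c s F i - price i (s i)

/-- The all-truthful profile `(sᵗ, …, sᵗ)`. -/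
def truthProfile (N : ℕ) : Profile N := fun _ => sT

/-- `s⃗` is an equilibrium of the protocol `F = (F_1,…,F_N)`. -/
def Equilibrium {N : ℕ} (g : Bits N → Bool) (c : Fin N → ℝ) (price : Fin N → Strategy → ℝ)
    (s : Profile N) (FF : Fin N → Protocol N) : Prop :=
  ∀ i : Fin N, ∀ s' : Strategy,
    U g c price s (FF i) i ≥ U g c price (Function.update s i s') (FF i) i

/-- The improvement `F_i⁺` of a protocol `F_i`: it agrees with `F_i` when `s_i` is a
zero-information strategy, and otherwise returns the reply whose first coordinate is
`m₀ = b₀` and whose remaining coordinates are those of `F_i`'s reply. -/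
def improve {N : ℕ} (i : Fin N) (F : Protocol N) : Protocol N := fun s m =>
  if ZeroInfo (s i) then F s m
  else PMF.map (fun f => Function.update f 0 (m 0)) (F s m)

/-- The center is helpless. -/
def Helpless (N : ℕ) (g : Bits N → Bool) (c : Fin N → ℝ)
    (price : Fin N → Strategy → ℝ) : Prop :=
  ∀ i : Fin N, ∀ F : Protocol N, ∀ si : Strategy, ¬ ZeroInfo si →
    ∀ sr : Profile N, (∀ j, ZeroInfo (sr j)) →
      U g c price sr F i ≥ U g c price (Function.update sr i si) (improve i F) i

/-- Relative price `price_i^r(s_i) = price_i(s_i) / price_i(sᵗ)`. -/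
def priceR {N : ℕ} (price : Fin N → Strategy → ℝ) (i : Fin N) (s : Strategy) : ℝ :=
  price i s / price i sT

/-- The competitive protocol (the component `F_i^c` for agent `i`). -/
def Fc {N : ℕ} (price : Fin N → Strategy → ℝ) (i : Fin N) : Protocol N := fun s m =>
  if ∀ j, s j = sT then PMF.pure m
  else if ∀ j, j ≠ i → priceR price j (s j) < priceR price i (s i) then PMF.pure m
  else PMF.uniformOfFintype (Bits N)

/-- The protocol that always replies the full message vector `m = (b₀, m₁, …, m_N)`. -/
def Fmax (N : ℕ) : Protocol N := fun _ m => PMF.pure m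

/-- The protocol that always replies `N+1` independent uniform random bits. -/
def Fmin (N : ℕ) : Protocol N := fun _ _ => PMF.uniformOfFintype (Bits N)

/-- Agent `i` is fanatic. -/
def Fanatic {N : ℕ} (g : Bits N → Bool) (c : Fin N → ℝ) (price : Fin N → Strategy → ℝ)
    (i : Fin N) : Prop :=
  ∀ s : Profile N,
    price i sT > V g c (truthProfile N) (Fmax N) i - V g c s (Fmin N) i

/-- The fair competitive protocol (the component `F_i^{fc}` for agent `i`). -/
def Ffc {N : ℕ} (price : Fin N → Strategy → ℝ) (i : Fin N) : Protocol N := fun s m =>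
  if s i = sT then PMF.pure m
  else if (∃ j, j ≠ i ∧ s j ≠ sT) ∧
      (∀ j, j ≠ i → s j ≠ sT → priceR price j (s j) < priceR price i (s i)) then PMF.pure m
  else PMF.uniformOfFintype (Bits N)

lemma guess_eq_max (x y : ℝ) :
    (if x > y then x else if y > x then y else (y + x) / 2) = max x y := by
  rcases lt_trichotomy x y with h | rfl | h
  · simp [h, h.le, h.not_gt]
  · simp
  · simp [h, h.le]

lemma V_eq_sum_max {N : ℕ} (g : Bits N → Bool) (c : Fin N → ℝ) (s : Profile N) (F : Protocol N)
    (i : Fin N) :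
    V g c s F i = c i * ∑ bi : Bool, ∑ mi : Bool, ∑ f : Bits N,
      max (pObs g s F i bi mi f true) (pObs g s F i bi mi f false) := by
  unfold V
  congr 1
  exact Finset.sum_congr rfl fun bi _ => Finset.sum_congr rfl fun mi _ =>
    Finset.sum_congr rfl fun f _ => guess_eq_max _ _

lemma V_congr {N : ℕ} (g : Bits N → Bool) (c : Fin N → ℝ) (s : Profile N) {F G : Protocol N}
    (i : Fin N) (h : F s = G s) : V g c s F i = V g c s G i := by
  have hobs : pObs g s F i = pObs g s G i := by
    funext bi mi f val
    simp only [pObs, jointP, h]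
  simp only [V_eq_sum_max, hobs]

lemma strandP_nonneg (s : Strategy) (bit msg : Bool) : 0 ≤ strandP s bit msg := by
  obtain ⟨⟨p, hp0, hp1⟩, ⟨q, hq0, hq1⟩⟩ := s
  cases bit <;> cases msg <;> simp [strandP, hp0, hp1, hq0, hq1]

lemma sum_strandP (s : Strategy) (bit : Bool) : ∑ msg : Bool, strandP s bit msg = 1 := by
  simp [strandP]

/-- Marginalizing `msgP` over all messages except that of agent `i`. -/
lemma sum_msgP {N : ℕ} (s : Profile N) (b : Bits N) (i : Fin N) (mi : Bool) :
    (∑ m : Bits N, if m i.succ = mi then msgP s b m else 0) = strandP (s i) (b i.succ) mi := by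
  let w : Fin (N + 1) → Bool → ℝ := Fin.cons (fun x => if x = b 0 then 1 else 0)
    (fun j x => strandP (s j) (b j.succ) x * if j = i → x = mi then 1 else 0)
  have hw (m : Bits N) : (if m i.succ = mi then msgP s b m else 0) = ∏ k, w k (m k) := by
    have hi : (∏ j : Fin N, if j = i → m j.succ = mi then (1 : ℝ) else 0)
        = if m i.succ = mi then 1 else 0 := by
      simp [Finset.prod_ite_zero]
    simp only [Fin.prod_univ_succ, w, Fin.cons_zero, Fin.cons_succ, Finset.prod_mul_distrib, hi,
      msgP]
    split_ifs <;> simp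
  simp_rw [hw]
  rw [← Fintype.prod_sum, Fin.prod_univ_succ, Fintype.prod_eq_single i]
  · simp [w]
  · intro j hj
    simpa [w, hj] using sum_strandP (s j) (b j.succ)

/-- Under `Fmin`, the reply and the message carry no information beyond `b i`. -/
lemma pObs_Fmin {N : ℕ} (g : Bits N → Bool) (s : Profile N) (i : Fin N) (bi mi : Bool)
    (f : Bits N) (val : Bool) :
    pObs g s (Fmin N) i bi mi f val = strandP (s i) bi mi *
      ∑ b : Bits N, if b i.succ = bi ∧ g b = val then
        (1 / 2 : ℝ) ^ (N + 1) * (PMF.uniformOfFintype (Bits N) f).toReal else 0 := by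
  unfold pObs
  rw [Finset.mul_sum]
  refine Finset.sum_congr rfl fun b _ => ?_
  by_cases hb : b i.succ = bi ∧ g b = val
  · have hm := sum_msgP s b i mi
    rw [hb.1] at hm
    rw [if_pos hb, ← hm, Finset.sum_mul]
    refine Finset.sum_congr rfl fun m _ => ?_
    by_cases hmi : m i.succ = mi
    · simp only [hb.1, hmi, hb.2, and_self, if_true, jointP, Fmin]
      ring
    · simp [hmi]
  · rw [if_neg hb, mul_zero]
    exact Finset.sum_eq_zero fun m _ => if_neg fun h => hb ⟨h.1, h.2.2⟩

lemma sum_max_pObs_Fmin {N : ℕ} (g : Bits N → Bool) (s : Profile N) (i : Fin N) (bi : Bool)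
    (f : Bits N) :
    ∑ mi : Bool, max (pObs g s (Fmin N) i bi mi f true) (pObs g s (Fmin N) i bi mi f false) =
      max (∑ b : Bits N, if b i.succ = bi ∧ g b = true then
          (1 / 2 : ℝ) ^ (N + 1) * (PMF.uniformOfFintype (Bits N) f).toReal else 0)
        (∑ b : Bits N, if b i.succ = bi ∧ g b = false then
          (1 / 2 : ℝ) ^ (N + 1) * (PMF.uniformOfFintype (Bits N) f).toReal else 0) := by
  generalize hx : (∑ b : Bits N, if b i.succ = bi ∧ g b = true then
    (1 / 2 : ℝ) ^ (N + 1) * (PMF.uniformOfFintype (Bits N) f).toReal else 0) = x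
  generalize hy : (∑ b : Bits N, if b i.succ = bi ∧ g b = false then
    (1 / 2 : ℝ) ^ (N + 1) * (PMF.uniformOfFintype (Bits N) f).toReal else 0) = y
  have hmax (mi : Bool) :
      max (pObs g s (Fmin N) i bi mi f true) (pObs g s (Fmin N) i bi mi f false) =
        strandP (s i) bi mi * max x y := by
    rw [pObs_Fmin, pObs_Fmin, hx, hy, mul_max_of_nonneg _ _ (strandP_nonneg _ _ _)]
  rw [Finset.sum_congr rfl fun mi _ => hmax mi, ← Finset.sum_mul, sum_strandP, one_mul]

/-- The profit under `Fmin` does not depend on the strategies. -/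
lemma V_Fmin_eq {N : ℕ} (g : Bits N → Bool) (c : Fin N → ℝ) (s t : Profile N) (i : Fin N) :
    V g c s (Fmin N) i = V g c t (Fmin N) i := by
  rw [V_eq_sum_max, V_eq_sum_max]
  refine congrArg (c i * ·) (Finset.sum_congr rfl fun bi _ => ?_)
  rw [Finset.sum_comm, Finset.sum_comm (s := Finset.univ (α := Bool))]
  exact Finset.sum_congr rfl fun f _ =>
    (sum_max_pObs_Fmin g s i bi f).trans (sum_max_pObs_Fmin g t i bi f).symm

lemma not_zeroInfo_sT : ¬ ZeroInfo sT := by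
  simp [ZeroInfo, sT]

/-- A unilateral deviation from truthfulness earns only random bits from `Fc`. -/
lemma Fc_update_truthProfile {N : ℕ} (hN : 2 ≤ N) {price : Fin N → Strategy → ℝ}
    (hpos : ∀ i, 0 < price i sT) (hmax : ∀ i s, price i s ≤ price i sT) (i : Fin N)
    {s' : Strategy} (hs : s' ≠ sT) :
    Fc price i (Function.update (truthProfile N) i s') =
      Fmin N (Function.update (truthProfile N) i s') := by
  have : Nontrivial (Fin N) := Fin.nontrivial_iff_two_le.mpr hN
  obtain ⟨j, hj⟩ := exists_ne i
  funext m
  unfold Fc Fmin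
  rw [if_neg fun h => hs (by simpa using h i), if_neg fun h => ?_]
  have hlt := h j hj
  simp only [Function.update_of_ne hj, Function.update_self, truthProfile, priceR,
    div_self (hpos j).ne'] at hlt
  exact hlt.not_ge ((div_le_one (hpos i)).mpr (hmax i s'))

/-- no truthful equilibrium in the competitive protocol implies a
fanatic agent exists. -/
theorem no_truthful_Fc_implies_fanatic (N : ℕ) (hN : 2 ≤ N) (g : Bits N → Bool) (c : Fin N → ℝ)
    (hc : ∀ i, 0 < c i)
    (price : Fin N → Strategy → ℝ)
    (hpriceCont : ∀ i, Continuous (price i))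
    (hprice0 : ∀ i s, ZeroInfo s → price i s = 0)
    (hpricePos : ∀ i s, ¬ ZeroInfo s → 0 < price i s)
    (hpriceMax : ∀ i s, price i s ≤ price i sT)
    (h : ¬ Equilibrium g c price (truthProfile N) (Fc price)) :
    ∃ i : Fin N, Fanatic g c price i := by
  have hpos i : 0 < price i sT := hpricePos i sT not_zeroInfo_sT
  simp only [Equilibrium, not_forall, ge_iff_le, not_le] at h
  obtain ⟨i, s', hdev⟩ := h
  have hs : s' ≠ sT := by
    rintro rfl
    have hself : Function.update (truthProfile N) i sT = truthProfile N :=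
      Function.update_eq_self i (truthProfile N)
    exact hdev.ne (by rw [hself])
  have htruth : Fc price i (truthProfile N) = Fmax N (truthProfile N) := by
    funext m
    simp [Fc, Fmax, truthProfile]
  refine ⟨i, fun s => ?_⟩
  have hprice : 0 ≤ price i s' := by
    by_cases hz : ZeroInfo s'
    · exact (hprice0 i s' hz).ge
    · exact (hpricePos i s' hz).le
  unfold U at hdev
  rw [V_congr g c _ i htruth,
    V_congr g c _ i (Fc_update_truthProfile hN hpos hpriceMax i hs),
    V_Fmin_eq g c _ s i, Function.update_self] at hdev
  simp only [truthProfile] at hdev ⊢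
  linarith

end
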